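/- Let K be a measurable function on ℍ^n \ {0}, C¹ away from 0, satisfying the Calderón–Zygmund regularity conditions |K(g)| ≤ C₀ ρ(g)^{−2n−2}, |∇_z K(g)| ≤ C₀ ρ(g)^{−2n−3}, |∂K/∂t(g)| ≤ C₀ ρ(g)^{−2n−4} for g ≠ 0, and the cancellation condition: for every normalized bump function φ, every r > 0 and every η > 0, |∫_{ρ(g) > η} K(g) φ(δ_r(g)) dg| ≤ C₀. Let ψ be a smooth function on ℍ^n supported in the ρ-ball {ρ(g) ≤ c₀} for a suitable small constant c₀ = c₀(n) ∈ (0,1), with ∫_{ℍ^n} ψ(g) dg = 0, and suppose the principal-value convolution (ψ ∗ D_{2^{−j}}K)(g) := lim_{η→0⁺} ∫_{ρ(h)>η} ψ(g∘h^{-1}) (D_{2^{−j}}K)(h) dh exists for all j ∈ ℤ and g. Then there is a constant C, independent of j, such that |(ψ ∗ D_{2^{−j}}K)(g)| ≤ C (1 + ρ(g))^{−(2n+3)} for all j ∈ ℤ and all g ∈ ℍ^n. -/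

import Mathlib

open MeasureTheory Filter

/-- The underlying space of the Heisenberg group `ℍⁿ ≅ ℝⁿ × ℝⁿ × ℝ`. -/
abbrev Heis (n : ℕ) := (Fin n → ℝ) × (Fin n → ℝ) × ℝ

/-- The Heisenberg group law. -/
def hmul {n : ℕ} (g g' : Heis n) : Heis n :=
  (g.1 + g'.1, g.2.1 + g'.2.1,
    g.2.2 + g'.2.2 + 2 * (∑ i, g.2.1 i * g'.1 i) - 2 * (∑ i, g.1 i * g'.2.1 i))

/-- The Heisenberg group inverse. -/
def hinv {n : ℕ} (g : Heis n) : Heis n := (-g.1, -g.2.1, -g.2.2)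

/-- The Euclidean norm of the horizontal component `z = (x, y) ∈ ℝ^{2n}`. -/
noncomputable def znorm {n : ℕ} (g : Heis n) : ℝ :=
  Real.sqrt (∑ i, g.1 i ^ 2 + ∑ i, g.2.1 i ^ 2)

/-- The homogeneous norm `ρ([z,t]) = max {|z|, |t|^{1/2}}`. -/
noncomputable def hnorm {n : ℕ} (g : Heis n) : ℝ :=
  max (znorm g) (Real.sqrt |g.2.2|)

/-- The anisotropic dilations `δ_r([z,t]) = [rz, r²t]`. -/
def hdil {n : ℕ} (r : ℝ) (g : Heis n) : Heis n := (r • g.1, r • g.2.1, r ^ 2 * g.2.2)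

/-- The normalized dilation `D_r f(g) = r^{2n+2} f(δ_r g)`. -/
noncomputable def hdilNorm {n : ℕ} (r : ℝ) (f : Heis n → ℝ) (g : Heis n) : ℝ :=
  r ^ (2 * n + 2) * f (hdil r g)

/-- The Euclidean length of the horizontal gradient `∇_z f` (gradient in the `2n`
variables `(x, y)`). -/
noncomputable def zgrad {n : ℕ} (f : Heis n → ℝ) (g : Heis n) : ℝ :=
  Real.sqrt (∑ i, fderiv ℝ f g (Pi.single i 1, 0, 0) ^ 2 +
      ∑ i, fderiv ℝ f g (0, Pi.single i 1, 0) ^ 2)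

/-- The derivative `∂f/∂t` in the central variable. -/
noncomputable def tderiv {n : ℕ} (f : Heis n → ℝ) (g : Heis n) : ℝ :=
  fderiv ℝ f g (0, 0, 1)

/-- The `i`-th coordinate direction in `ℝ^{2n+1}`. -/
def evec {n : ℕ} (i : Fin (2 * n + 1)) : Heis n :=
  if h : (i : ℕ) < n then (Pi.single ⟨i, h⟩ 1, 0, 0)
  else if h2 : (i : ℕ) < 2 * n then (0, Pi.single ⟨(i : ℕ) - n, by omega⟩ 1, 0)
  else (0, 0, 1)

/-- The `i`-th coordinate partial derivative `∂/∂(z,t)_i`. -/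
noncomputable def pop {n : ℕ} (i : Fin (2 * n + 1)) (f : Heis n → ℝ) (g : Heis n) : ℝ :=
  fderiv ℝ f g (evec i)

/-- `∂^I_{z,t} = ∂₁^{i₁} ∂₂^{i₂} ⋯ ∂_{2n+1}^{i_{2n+1}}` for a multi-index `I`. -/
noncomputable def piter {n : ℕ} (I : Fin (2 * n + 1) → ℕ) (f : Heis n → ℝ) : Heis n → ℝ :=
  (List.finRange (2 * n + 1)).foldr (fun i F => (pop i)^[I i] F) f

/-- A normalized bump function on `ℍⁿ`: smooth, supported in the unit ball
`{ρ(g) ≤ 1}`, with `|∂^I_{z,t} φ| ≤ 1` for all multi-indices `I` with `|I| ≤ N`. -/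
def IsBump (n N : ℕ) (φ : Heis n → ℝ) : Prop :=
  ContDiff ℝ (⊤ : ℕ∞) φ ∧ Function.support φ ⊆ {g : Heis n | hnorm g ≤ 1} ∧
    ∀ I : Fin (2 * n + 1) → ℕ, (∑ i, I i) ≤ N → ∀ g : Heis n, |piter I φ g| ≤ 1

/-- The Calderón–Zygmund conditions on a convolution kernel `K` on `ℍⁿ`:
size and smoothness estimates away from the origin, together with uniform
cancellation against dilated normalized bump functions (with truncations). -/
def IsCZKernel (n N : ℕ) (K : Heis n → ℝ) (C₀ : ℝ) : Prop :=
  ContDiffOn ℝ 1 K {g : Heis n | g ≠ 0} ∧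
  (∀ g : Heis n, g ≠ 0 → |K g| ≤ C₀ / hnorm g ^ (2 * n + 2)) ∧
  (∀ g : Heis n, g ≠ 0 → zgrad K g ≤ C₀ / hnorm g ^ (2 * n + 3)) ∧
  (∀ g : Heis n, g ≠ 0 → |tderiv K g| ≤ C₀ / hnorm g ^ (2 * n + 4)) ∧
  (∀ φ : Heis n → ℝ, IsBump n N φ → ∀ r : ℝ, 0 < r → ∀ η : ℝ, 0 < η →
    |∫ g in {g : Heis n | η < hnorm g}, K g * φ (hdil r g)| ≤ C₀)

lemma znorm_nonneg {n : ℕ} (g : Heis n) : 0 ≤ znorm g := Real.sqrt_nonneg _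

lemma hnorm_nonneg {n : ℕ} (g : Heis n) : 0 ≤ hnorm g := (znorm_nonneg g).trans (le_max_left _ _)

lemma znorm_le_hnorm {n : ℕ} (g : Heis n) : znorm g ≤ hnorm g := le_max_left _ _

lemma hnorm_le_iff {n : ℕ} {g : Heis n} {R : ℝ} (hR : 0 ≤ R) :
    hnorm g ≤ R ↔ znorm g ≤ R ∧ |g.2.2| ≤ R ^ 2 := by
  rw [hnorm, max_le_iff, Real.sqrt_le_left hR]

lemma abs_central_le {n : ℕ} (g : Heis n) : |g.2.2| ≤ hnorm g ^ 2 :=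
  ((hnorm_le_iff (hnorm_nonneg g)).1 le_rfl).2

lemma hnorm_zero {n : ℕ} : hnorm (0 : Heis n) = 0 := by
  simp [hnorm, znorm]

lemma ne_zero_of_hnorm_pos {n : ℕ} {g : Heis n} (h : 0 < hnorm g) : g ≠ 0 := by
  rintro rfl
  exact h.ne' hnorm_zero

lemma continuous_hnorm {n : ℕ} : Continuous (hnorm : Heis n → ℝ) := by
  unfold hnorm znorm
  fun_prop

lemma znorm_hdil {n : ℕ} {r : ℝ} (hr : 0 ≤ r) (g : Heis n) : znorm (hdil r g) = r * znorm g := by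
  have h : ∑ i, (r • g.1) i ^ 2 + ∑ i, (r • g.2.1) i ^ 2 =
      r ^ 2 * (∑ i, g.1 i ^ 2 + ∑ i, g.2.1 i ^ 2) := by
    simp only [Pi.smul_apply, smul_eq_mul, mul_pow, mul_add, Finset.mul_sum]
  change Real.sqrt (∑ i, (r • g.1) i ^ 2 + ∑ i, (r • g.2.1) i ^ 2) = _
  rw [h, Real.sqrt_mul (sq_nonneg r), Real.sqrt_sq hr, znorm]

lemma hnorm_hdil {n : ℕ} {r : ℝ} (hr : 0 ≤ r) (g : Heis n) : hnorm (hdil r g) = r * hnorm g := by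
  have h : Real.sqrt |(hdil r g).2.2| = r * Real.sqrt |g.2.2| := by
    change Real.sqrt |r ^ 2 * g.2.2| = _
    rw [abs_mul, abs_of_nonneg (sq_nonneg r), Real.sqrt_mul (sq_nonneg r), Real.sqrt_sq hr]
  rw [hnorm, hnorm, h, znorm_hdil hr, mul_max_of_nonneg _ _ hr]

lemma hdil_hdil {n : ℕ} (r s : ℝ) (g : Heis n) : hdil r (hdil s g) = hdil (r * s) g := by
  simp only [hdil, smul_smul, Prod.mk.injEq, true_and]
  ring

lemma hdil_one {n : ℕ} (g : Heis n) : hdil 1 g = g := by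
  simp [hdil]

/-- Cauchy–Schwarz for the horizontal components. -/
lemma abs_sum_add_sum_le {n : ℕ} (a b c d : Fin n → ℝ) :
    |∑ i, a i * c i + ∑ i, b i * d i| ≤
      Real.sqrt (∑ i, a i ^ 2 + ∑ i, b i ^ 2) * Real.sqrt (∑ i, c i ^ 2 + ∑ i, d i ^ 2) := by
  have h := Finset.sum_mul_sq_le_sq_mul_sq Finset.univ (Sum.elim a b) (Sum.elim c d)
  simp only [Fintype.sum_sum_type, Sum.elim_inl, Sum.elim_inr] at h
  rw [← Real.sqrt_mul (by positivity)]
  exact Real.abs_le_sqrt h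

lemma abs_symplectic_le {n : ℕ} (g u : Heis n) :
    |∑ i, g.2.1 i * u.1 i - ∑ i, g.1 i * u.2.1 i| ≤ znorm g * znorm u := by
  have h := abs_sum_add_sum_le g.2.1 (-g.1) u.1 u.2.1
  simp only [Pi.neg_apply, neg_mul, Finset.sum_neg_distrib, neg_sq] at h
  rw [add_comm (∑ i, g.2.1 i ^ 2)] at h
  exact h

lemma znorm_eq_norm {n : ℕ} (g : Heis n) :
    znorm g = ‖(WithLp.toLp 2 (Sum.elim g.1 g.2.1) : EuclideanSpace ℝ (Fin n ⊕ Fin n))‖ := by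
  rw [EuclideanSpace.norm_eq, znorm]
  simp

lemma znorm_add_le {n : ℕ} (g h : Heis n) : znorm (g + h) ≤ znorm g + znorm h := by
  have : (WithLp.toLp 2 (Sum.elim (g + h).1 (g + h).2.1) : EuclideanSpace ℝ (Fin n ⊕ Fin n)) =
      WithLp.toLp 2 (Sum.elim g.1 g.2.1) + WithLp.toLp 2 (Sum.elim h.1 h.2.1) := by
    ext i
    cases i <;> simp
  rw [znorm_eq_norm, this, znorm_eq_norm g, znorm_eq_norm h]
  exact norm_add_le _ _

lemma znorm_smul {n : ℕ} (s : ℝ) (g : Heis n) : znorm (s • g) = |s| * znorm g := by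
  have : (WithLp.toLp 2 (Sum.elim (s • g).1 (s • g).2.1) : EuclideanSpace ℝ (Fin n ⊕ Fin n)) =
      s • WithLp.toLp 2 (Sum.elim g.1 g.2.1) := by
    ext i
    cases i <;> simp
  rw [znorm_eq_norm, this, norm_smul, znorm_eq_norm, Real.norm_eq_abs]

lemma znorm_neg {n : ℕ} (g : Heis n) : znorm (-g) = znorm g := by
  simp [znorm]

lemma hdil_add {n : ℕ} (r : ℝ) (g h : Heis n) : hdil r (g + h) = hdil r g + hdil r h := by
  simp [hdil, mul_add]

lemma hdil_smul {n : ℕ} (r s : ℝ) (g : Heis n) : hdil r (s • g) = s • hdil r g := by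
  simp [hdil, smul_comm r s, mul_left_comm]

/-- The displacement from `g` to `h` in terms of `u = g ∘ h⁻¹`. -/
lemma znorm_sub_eq {n : ℕ} (g h : Heis n) : znorm (h - g) = znorm (hmul g (hinv h)) := by
  have : znorm (hmul g (hinv h)) = znorm (-(h - g)) := by
    simp [znorm, hmul, hinv, sub_eq_add_neg, add_comm]
  rw [this, znorm_neg]

lemma abs_central_sub_le {n : ℕ} (g h : Heis n) :
    |(h - g).2.2| ≤ |(hmul g (hinv h)).2.2| + 2 * (znorm g * znorm (h - g)) := by
  have key : (h - g).2.2 = -(hmul g (hinv h)).2.2 -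
      2 * (∑ i, g.2.1 i * (h - g).1 i - ∑ i, g.1 i * (h - g).2.1 i) := by
    have e : ∑ i, g.2.1 i * g.1 i = ∑ i, g.1 i * g.2.1 i :=
      Finset.sum_congr rfl fun i _ => mul_comm _ _
    simp only [hmul, hinv, Prod.fst_sub, Prod.snd_sub, Pi.sub_apply, Pi.neg_apply, mul_sub, mul_neg,
      Finset.sum_sub_distrib, Finset.sum_neg_distrib, e]
    ring
  have h1 := abs_symplectic_le g (h - g)
  rw [key]
  refine (abs_sub _ _).trans ?_
  rw [abs_neg, abs_mul, abs_two]
  linarith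

/-- A Euclidean displacement of the size produced by left multiplication with a small element
keeps a point away from the origin. -/
lemma half_hnorm_le_hnorm_add {n : ℕ} {g v : Heis n} (hg : 1 ≤ hnorm g)
    (hz : znorm v ≤ 1 / 8) (ht : |v.2.2| ≤ hnorm g / 2) : hnorm g / 2 ≤ hnorm (g + v) := by
  rcases max_choice (znorm g) (Real.sqrt |g.2.2|) with h | h
  · have h1 : znorm g ≤ znorm (g + v) + znorm (-v) := by
      simpa using znorm_add_le (g + v) (-v)
    have h2 := znorm_le_hnorm (g + v)
    rw [znorm_neg] at h1
    change hnorm g = _ at h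
    linarith
  · change hnorm g = _ at h
    have h1 : hnorm g ^ 2 = |g.2.2| := by rw [h, Real.sq_sqrt (abs_nonneg _)]
    have h2 : |g.2.2| ≤ |(g + v).2.2| + |v.2.2| := by
      have := abs_sub (g + v).2.2 v.2.2
      simpa using this
    have h3 := abs_central_le (g + v)
    refine (pow_le_pow_iff_left₀ (by linarith) (hnorm_nonneg _) two_ne_zero).1 ?_
    nlinarith

lemma hnorm_le_two_of_hmul_hinv {n : ℕ} {g h : Heis n} (hg : hnorm g ≤ 1)
    (hu : hnorm (hmul g (hinv h)) ≤ 1 / 8) : hnorm h ≤ 2 := by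
  have hz : znorm (h - g) ≤ 1 / 8 := (znorm_sub_eq g h).trans_le ((znorm_le_hnorm _).trans hu)
  have ht := abs_central_sub_le g h
  have h1 : |(hmul g (hinv h)).2.2| ≤ (1 / 8) ^ 2 := ((hnorm_le_iff (by norm_num)).1 hu).2
  obtain ⟨h2, h3⟩ := (hnorm_le_iff zero_le_one).1 hg
  have h4 : znorm g * znorm (h - g) ≤ 1 * (1 / 8) :=
    mul_le_mul h2 hz (znorm_nonneg _) zero_le_one
  refine (hnorm_le_iff zero_le_two).2 ⟨?_, ?_⟩
  · have := znorm_add_le g (h - g)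
    rw [add_sub_cancel] at this
    linarith
  · have h5 : |h.2.2| ≤ |g.2.2| + |(h - g).2.2| := by
      have := abs_add_le g.2.2 (h - g).2.2
      simpa using this
    linarith

lemma measurePreserving_hmul_hinv {n : ℕ} (g : Heis n) :
    MeasurePreserving (fun h : Heis n => hmul g (hinv h)) := by
  have hx (x₀ : Fin n → ℝ) : MeasurePreserving (fun x : Fin n → ℝ => x₀ - x) :=
    Measure.measurePreserving_sub_left volume x₀
  have ht (c : ℝ) : MeasurePreserving (fun t : ℝ => c - t) := Measure.measurePreserving_sub_left volume c
  have h1 (x : Fin n → ℝ) : MeasurePreserving (fun p : (Fin n → ℝ) × ℝ =>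
      (g.2.1 - p.1, (g.2.2 + 2 * (∑ i, g.1 i * p.1 i) - 2 * (∑ i, g.2.1 i * x i)) - p.2)) :=
    (hx g.2.1).skew_product (g := fun y t =>
      (g.2.2 + 2 * (∑ i, g.1 i * y i) - 2 * (∑ i, g.2.1 i * x i)) - t)
      (by unfold Function.uncurry; fun_prop) (Eventually.of_forall fun y => (ht _).map_eq)
  have h2 := (hx g.1).skew_product (g := fun x (p : (Fin n → ℝ) × ℝ) =>
      (g.2.1 - p.1, (g.2.2 + 2 * (∑ i, g.1 i * p.1 i) - 2 * (∑ i, g.2.1 i * x i)) - p.2))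
      (by unfold Function.uncurry; fun_prop) (Eventually.of_forall fun x => (h1 x).map_eq)
  refine (congrArg (MeasurePreserving · volume volume) (funext fun h => ?_)).mp h2
  simp only [hmul, hinv, Pi.neg_apply, mul_neg, Finset.sum_neg_distrib, sub_eq_add_neg]
  ring_nf

/-- The dilation `δ_r` as a linear map. -/
def hdilLin (n : ℕ) (r : ℝ) : Heis n →ₗ[ℝ] Heis n :=
  (r • LinearMap.id).prodMap ((r • LinearMap.id).prodMap (r ^ 2 • LinearMap.id))

lemma det_hdilLin (n : ℕ) (r : ℝ) : LinearMap.det (hdilLin n r) = r ^ (2 * n + 2) := by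
  simp only [hdilLin, LinearMap.det_prodMap, LinearMap.det_smul, LinearMap.det_id,
    Module.finrank_fin_fun, Module.finrank_self]
  ring

instance {n : ℕ} : (volume : Measure (Heis n)).IsAddHaarMeasure :=
  have : (volume : Measure ((Fin n → ℝ) × ℝ)).IsAddHaarMeasure :=
    Measure.prod.instIsAddHaarMeasure _ _
  Measure.prod.instIsAddHaarMeasure _ _

lemma map_hdil {n : ℕ} {r : ℝ} (hr : 0 < r) :
    Measure.map (hdil r) (volume : Measure (Heis n)) =
      ENNReal.ofReal ((r ^ (2 * n + 2))⁻¹) • volume := by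
  have h := Measure.map_linearMap_addHaar_eq_smul_addHaar (volume : Measure (Heis n))
    (f := hdilLin n r) (by rw [det_hdilLin]; positivity)
  rw [det_hdilLin, abs_of_pos (by positivity)] at h
  exact h

lemma continuous_hdil {n : ℕ} (r : ℝ) : Continuous (hdil r : Heis n → Heis n) := by
  unfold hdil
  fun_prop

lemma measurableEmbedding_hdil {n : ℕ} {r : ℝ} (hr : 0 < r) :
    MeasurableEmbedding (hdil r : Heis n → Heis n) := by
  refine (continuous_hdil r).measurableEmbedding fun g h hgh => ?_
  have := congrArg (hdil r⁻¹) hgh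
  simpa [hdil_hdil, inv_mul_cancel₀ hr.ne', hdil_one] using this

lemma setIntegral_hdil {n : ℕ} {r : ℝ} (hr : 0 < r) (F : Heis n → ℝ) (η : ℝ) :
    ∫ h in {h : Heis n | η < hnorm h}, r ^ (2 * n + 2) * F (hdil r h) =
      ∫ h in {h : Heis n | r * η < hnorm h}, F h := by
  have hS : {h : Heis n | η < hnorm h} = hdil r ⁻¹' {h : Heis n | r * η < hnorm h} := by
    ext h
    simp [hnorm_hdil hr.le, hr]
  have h := (measurableEmbedding_hdil hr).setIntegral_map (μ := volume) F
    {h : Heis n | r * η < hnorm h}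
  rw [map_hdil hr, Measure.restrict_smul, integral_smul_measure,
    ENNReal.toReal_ofReal (by positivity), ← hS] at h
  rw [integral_const_mul, ← h, smul_eq_mul, ← mul_assoc, mul_inv_cancel₀ (by positivity), one_mul]

lemma abs_fderiv_le {n : ℕ} (f : Heis n → ℝ) (p v : Heis n) :
    |fderiv ℝ f p v| ≤ zgrad f p * znorm v + |tderiv f p| * |v.2.2| := by
  have hv : v = (∑ i, v.1 i • ((Pi.single i 1, 0, 0) : Heis n) +
      ∑ i, v.2.1 i • ((0, Pi.single i 1, 0) : Heis n)) + v.2.2 • ((0, 0, 1) : Heis n) := by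
    refine Prod.ext ?_ (Prod.ext ?_ ?_)
    · ext j
      simp [Prod.fst_sum, Finset.sum_apply, Pi.single_apply]
    · ext j
      simp [Prod.fst_sum, Prod.snd_sum, Finset.sum_apply, Pi.single_apply]
    · simp [Prod.snd_sum]
  have he : fderiv ℝ f p v = (∑ i, fderiv ℝ f p (Pi.single i 1, 0, 0) * v.1 i +
      ∑ i, fderiv ℝ f p (0, Pi.single i 1, 0) * v.2.1 i) + tderiv f p * v.2.2 := by
    conv_lhs => rw [hv]
    simp only [map_add, map_sum, map_smul, smul_eq_mul, tderiv, mul_comm]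
  rw [he, ← abs_mul]
  exact (abs_add_le _ _).trans (add_le_add_left (abs_sum_add_sum_le _ _ _ _) _)

lemma IsCZKernel.abs_sub_le {n N : ℕ} {K : Heis n → ℝ} {C₀ : ℝ} (hK : IsCZKernel n N K C₀)
    (hC₀ : 0 ≤ C₀) {g v : Heis n} {R : ℝ} (hR : 0 < R)
    (hseg : ∀ s ∈ Set.Icc (0 : ℝ) 1, R ≤ hnorm (g + s • v)) :
    |K (g + v) - K g| ≤ C₀ / R ^ (2 * n + 3) * znorm v + C₀ / R ^ (2 * n + 4) * |v.2.2| := by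
  obtain ⟨hdiff, -, hz, ht, -⟩ := hK
  have hd : ∀ s ∈ Set.Icc (0 : ℝ) 1, HasDerivWithinAt (fun s : ℝ => K (g + s • v))
      (fderiv ℝ K (g + s • v) v) (Set.Icc 0 1) s := by
    intro s hs
    have h0 : g + s • v ≠ 0 := ne_zero_of_hnorm_pos (hR.trans_le (hseg s hs))
    have hKd : HasFDerivAt K (fderiv ℝ K (g + s • v)) (g + s • v) :=
      ((hdiff.contDiffAt (isOpen_ne.mem_nhds h0)).differentiableAt one_ne_zero).hasFDerivAt
    have hl : HasDerivAt (fun s : ℝ => g + s • v) v s := by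
      simpa using ((hasDerivAt_id s).smul_const v).const_add g
    exact (hKd.comp_hasDerivAt s hl).hasDerivWithinAt
  have hb : ∀ s ∈ Set.Ico (0 : ℝ) 1, ‖fderiv ℝ K (g + s • v) v‖ ≤
      C₀ / R ^ (2 * n + 3) * znorm v + C₀ / R ^ (2 * n + 4) * |v.2.2| := by
    intro s hs
    have hρ := hseg s (Set.Ico_subset_Icc_self hs)
    have h0 : g + s • v ≠ 0 := ne_zero_of_hnorm_pos (hR.trans_le hρ)
    have h1 : zgrad K (g + s • v) ≤ C₀ / R ^ (2 * n + 3) := (hz _ h0).trans (by gcongr)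
    have h2 : |tderiv K (g + s • v)| ≤ C₀ / R ^ (2 * n + 4) := (ht _ h0).trans (by gcongr)
    refine (abs_fderiv_le K _ v).trans ?_
    have := znorm_nonneg v
    gcongr
  simpa using norm_image_sub_le_of_norm_deriv_le_segment_01' hd hb

/-- The smoothness estimate for the rescaled kernels, uniformly in the scale. -/
lemma IsCZKernel.abs_hdilNorm_sub_le {n N : ℕ} {K : Heis n → ℝ} {C₀ : ℝ}
    (hK : IsCZKernel n N K C₀) (hC₀ : 0 ≤ C₀) {r : ℝ} (hr : 0 < r) {g h : Heis n}
    (hg : 1 ≤ hnorm g) (hu : hnorm (hmul g (hinv h)) ≤ 1 / 8) :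
    hnorm g / 2 ≤ hnorm h ∧ |hdilNorm r K h - hdilNorm r K g| ≤
      C₀ * 2 ^ (2 * n + 4) / hnorm g ^ (2 * n + 3) := by
  set v := h - g with hv
  have hz : znorm v ≤ 1 / 8 := (znorm_sub_eq g h).trans_le ((znorm_le_hnorm _).trans hu)
  have ht : |v.2.2| ≤ hnorm g / 2 := by
    have h1 := abs_central_sub_le g h
    have h2 : |(hmul g (hinv h)).2.2| ≤ (1 / 8) ^ 2 := ((hnorm_le_iff (by norm_num)).1 hu).2
    have h3 : znorm g * znorm v ≤ hnorm g * (1 / 8) :=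
      mul_le_mul (znorm_le_hnorm g) hz (znorm_nonneg _) (hnorm_nonneg _)
    linarith
  have hseg : ∀ s ∈ Set.Icc (0 : ℝ) 1, hnorm g / 2 ≤ hnorm (g + s • v) := by
    intro s hs
    refine half_hnorm_le_hnorm_add hg ?_ ?_
    · rw [znorm_smul, abs_of_nonneg hs.1]
      exact (mul_le_of_le_one_left (znorm_nonneg _) hs.2).trans hz
    · rw [Prod.smul_snd, Prod.smul_snd, smul_eq_mul, abs_mul, abs_of_nonneg hs.1]
      exact (mul_le_of_le_one_left (abs_nonneg _) hs.2).trans ht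
  have hgv : g + v = h := add_sub_cancel g h
  refine ⟨by simpa [hgv] using hseg 1 (by simp), ?_⟩
  have hseg' : ∀ s ∈ Set.Icc (0 : ℝ) 1, r * (hnorm g / 2) ≤ hnorm (hdil r g + s • hdil r v) := by
    intro s hs
    rw [← hdil_smul, ← hdil_add, hnorm_hdil hr.le]
    exact mul_le_mul_of_nonneg_left (hseg s hs) hr.le
  have hρ : 0 < hnorm g := zero_lt_one.trans_le hg
  have hmain := hK.abs_sub_le hC₀ (R := r * (hnorm g / 2)) (by positivity) hseg'
  rw [← hdil_add, hgv, znorm_hdil hr.le] at hmain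
  have htv : |(hdil r v).2.2| = r ^ 2 * |v.2.2| := by
    simp [hdil, abs_mul]
  rw [htv] at hmain
  unfold hdilNorm
  rw [← mul_sub, abs_mul, abs_of_pos (by positivity)]
  calc r ^ (2 * n + 2) * |K (hdil r h) - K (hdil r g)|
      ≤ r ^ (2 * n + 2) * (C₀ / (r * (hnorm g / 2)) ^ (2 * n + 3) * (r * znorm v) +
          C₀ / (r * (hnorm g / 2)) ^ (2 * n + 4) * (r ^ 2 * |v.2.2|)) := by gcongr
    _ = C₀ / (hnorm g / 2) ^ (2 * n + 3) * znorm v +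
          C₀ / (hnorm g / 2) ^ (2 * n + 4) * |v.2.2| := by
        simp only [mul_pow, pow_add, pow_mul]
        field_simp
    _ ≤ C₀ / (hnorm g / 2) ^ (2 * n + 3) * 1 +
          C₀ / (hnorm g / 2) ^ (2 * n + 4) * (hnorm g / 2) := by
        gcongr
        linarith
    _ = C₀ * 2 ^ (2 * n + 4) / hnorm g ^ (2 * n + 3) := by
        simp only [div_pow, pow_succ]
        field_simp
        ring

/-- Properties of families of functions that are stable under partial derivatives are stable
under `piter`. -/
lemma piter_induction {n : ℕ} {A : Type*} {P : (A → Heis n → ℝ) → Prop}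
    (hP : ∀ i F, P F → P fun a => pop i (F a)) (I : Fin (2 * n + 1) → ℕ) {F : A → Heis n → ℝ}
    (hF : P F) : P fun a => piter I (F a) := by
  unfold piter
  induction List.finRange (2 * n + 1) with
  | nil => exact hF
  | cons i l ih =>
    simp only [List.foldr_cons]
    generalize I i = k
    induction k with
    | zero => exact ih
    | succ k ihk =>
      simp only [Function.iterate_succ_apply']
      exact hP i _ ihk

lemma piter_const_smul {n : ℕ} (I : Fin (2 * n + 1) → ℕ) (c : ℝ) (f : Heis n → ℝ) :
    piter I (c • f) = c • piter I f := by
  have h := piter_induction (P := fun F : ℝ → Heis n → ℝ => ∀ c, F c = c • F 1)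
    (fun i F hF c => by
      ext g
      simp only [pop, hF c, Pi.smul_apply, fderiv_const_smul_field, smul_apply])
    I (F := fun c => c • f) (fun c => by simp) c
  simpa using h

lemma pop_uncurry {n : ℕ} {F : Heis n → Heis n → ℝ}
    (hF : ContDiff ℝ (⊤ : ℕ∞) (Function.uncurry F)) (i : Fin (2 * n + 1)) (g h : Heis n) :
    pop i (F g) h = fderiv ℝ (Function.uncurry F) (g, h) (0, evec i) := by
  have h1 := (hF.differentiable (by simp) (g, h)).hasFDerivAt.comp h
    (hasFDerivAt_prodMk_right (𝕜 := ℝ) g h)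
  have h2 : HasFDerivAt (F g) _ h := h1
  rw [pop, h2.fderiv]
  rfl

lemma isCompact_hnorm_le {n : ℕ} (R : ℝ) : IsCompact {g : Heis n | hnorm g ≤ R} := by
  refine Metric.isCompact_of_isClosed_isBounded (isClosed_le continuous_hnorm continuous_const) ?_
  refine (Metric.isBounded_closedBall (x := (0 : Heis n)) (r := max R (R ^ 2))).subset
    fun g hg => ?_
  have hR : 0 ≤ R := (hnorm_nonneg g).trans hg
  obtain ⟨hz, ht⟩ := (hnorm_le_iff hR).1 hg
  have hx (i : Fin n) : |g.1 i| ≤ R := by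
    refine (Real.abs_le_sqrt ?_).trans hz
    have := Finset.single_le_sum (fun j _ => sq_nonneg (g.1 j)) (Finset.mem_univ i)
    have : 0 ≤ ∑ j, g.2.1 j ^ 2 := by positivity
    linarith
  have hy (i : Fin n) : |g.2.1 i| ≤ R := by
    refine (Real.abs_le_sqrt ?_).trans hz
    have := Finset.single_le_sum (fun j _ => sq_nonneg (g.2.1 j)) (Finset.mem_univ i)
    have : 0 ≤ ∑ j, g.1 j ^ 2 := by positivity
    linarith
  rw [mem_closedBall_zero_iff]
  refine max_le ?_ (max_le ?_ ?_)
  · exact ((pi_norm_le_iff_of_nonneg hR).2 hx).trans (le_max_left _ _)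
  · exact ((pi_norm_le_iff_of_nonneg hR).2 hy).trans (le_max_left _ _)
  · exact ht.trans (le_max_right _ _)

/-- The derivatives of a smooth family of functions supported in the unit ball are uniformly
bounded when the parameter stays in the unit ball. -/
lemma exists_piter_bound {n : ℕ} (N : ℕ) {F : Heis n → Heis n → ℝ}
    (hF : ContDiff ℝ (⊤ : ℕ∞) (Function.uncurry F))
    (hsupp : ∀ g, hnorm g ≤ 1 → Function.support (F g) ⊆ {h | hnorm h ≤ 1}) :
    ∃ M : ℝ, 0 < M ∧ ∀ I : Fin (2 * n + 1) → ℕ, (∑ i, I i) ≤ N → ∀ g, hnorm g ≤ 1 →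
      ∀ h, |piter I (F g) h| ≤ M := by
  have hpi (I : Fin (2 * n + 1) → ℕ) :=
    piter_induction (P := fun F : Heis n → Heis n → ℝ =>
      ContDiff ℝ (⊤ : ℕ∞) (Function.uncurry F) ∧
        ∀ g, hnorm g ≤ 1 → Function.support (F g) ⊆ {h | hnorm h ≤ 1})
      (fun i F ⟨h1, h2⟩ => by
        refine ⟨?_, fun g hg h hh => ?_⟩
        · have : Function.uncurry (fun g => pop i (F g)) =
              fun p => fderiv ℝ (Function.uncurry F) p (0, evec i) :=
            funext fun p => pop_uncurry h1 i p.1 p.2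
          rw [this]
          exact (h1.fderiv_right (m := (⊤ : ℕ∞)) (by simp)).clm_apply contDiff_const
        · refine closure_minimal (h2 g hg) (isClosed_le continuous_hnorm continuous_const) ?_
          refine support_fderiv_subset ℝ (f := F g) fun h0 => hh ?_
          simp only [pop, h0, zero_apply])
      I ⟨hF, hsupp⟩
  have hb (I : Fin (2 * n + 1) → ℕ) : ∃ M : ℝ, ∀ g, hnorm g ≤ 1 → ∀ h,
      |piter I (F g) h| ≤ M := by
    obtain ⟨M, hM⟩ := ((isCompact_hnorm_le (n := n) 1).prod
      (isCompact_hnorm_le (n := n) 1)).exists_bound_of_continuousOn (hpi I).1.continuous.continuousOn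
    refine ⟨max M 0, fun g hg h => ?_⟩
    by_cases hh : hnorm h ≤ 1
    · exact (hM (g, h) ⟨hg, hh⟩).trans (le_max_left _ _)
    · have h0 : piter I (F g) h = 0 :=
        Function.notMem_support.1 fun h0 => hh ((hpi I).2 g hg h0)
      rw [h0, abs_zero]
      exact le_max_right _ _
  choose M hM using hb
  have hfin : {I : Fin (2 * n + 1) → ℕ | ∑ i, I i ≤ N}.Finite :=
    (Set.finite_Iic fun _ => N).subset fun I hI i =>
      (Finset.single_le_sum (fun _ _ => Nat.zero_le _) (Finset.mem_univ i)).trans hI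
  obtain ⟨B, hB⟩ := (hfin.image M).bddAbove
  exact ⟨max B 1, by positivity, fun I hI g hg h =>
    (hM I g hg h).trans ((hB ⟨I, hI, rfl⟩).trans (le_max_left _ _))⟩

/-- Near the origin the truncated convolutions are controlled by the cancellation condition. -/
lemma IsCZKernel.exists_bound_of_hnorm_le_one {n N : ℕ} {K : Heis n → ℝ} {C₀ : ℝ}
    (hK : IsCZKernel n N K C₀) {ψ : Heis n → ℝ} (hψ : ContDiff ℝ (⊤ : ℕ∞) ψ)
    (hsupp : Function.support ψ ⊆ {g | hnorm g ≤ 1 / 8}) :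
    ∃ M : ℝ, 0 < M ∧ ∀ r : ℝ, 0 < r → ∀ g, hnorm g ≤ 1 → ∀ η : ℝ, 0 < η →
      |∫ h in {h : Heis n | η < hnorm h}, ψ (hmul g (hinv h)) * hdilNorm r K h| ≤ M * C₀ := by
  set F : Heis n → Heis n → ℝ := fun g h => ψ (hmul g (hinv (hdil 2 h))) with hFdef
  have hF : ContDiff ℝ (⊤ : ℕ∞) (Function.uncurry F) := by
    refine hψ.comp ?_
    unfold hmul hinv hdil
    fun_prop
  have hFs : ∀ g, hnorm g ≤ 1 → Function.support (F g) ⊆ {h | hnorm h ≤ 1} := by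
    intro g hg h hh
    have h1 := hnorm_le_two_of_hmul_hinv hg (hsupp hh)
    rw [hnorm_hdil zero_le_two] at h1
    change hnorm h ≤ 1
    linarith
  obtain ⟨M, hM, hMb⟩ := exists_piter_bound N hF hFs
  refine ⟨M, hM, fun r hr g hg η hη => ?_⟩
  have hbump : IsBump n N (M⁻¹ • F g) := by
    refine ⟨?_, (Function.support_const_smul_subset _ _).trans (hFs g hg), fun I hI h => ?_⟩
    · exact (hF.comp (contDiff_const.prodMk contDiff_id)).const_smul M⁻¹
    · rw [piter_const_smul, Pi.smul_apply, smul_eq_mul, abs_mul, abs_inv, abs_of_pos hM]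
      exact inv_mul_le_one_of_le₀ (hMb I hI g hg h) hM.le
  have hc := hK.2.2.2.2 _ hbump (2 * r)⁻¹ (by positivity) (r * η) (by positivity)
  rw [← setIntegral_hdil hr] at hc
  have he : ∀ h, ψ (hmul g (hinv h)) * hdilNorm r K h =
      M * (r ^ (2 * n + 2) * (K (hdil r h) * (M⁻¹ • F g) (hdil (2 * r)⁻¹ (hdil r h)))) := by
    intro h
    have : 2 * ((2 * r)⁻¹ * r) = 1 := by field_simp
    simp only [hFdef, Pi.smul_apply, smul_eq_mul, hdil_hdil, this, hdil_one, hdilNorm]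
    field_simp
  simp only [he]
  rw [integral_const_mul, abs_mul, abs_of_pos hM]
  exact mul_le_mul_of_nonneg_left hc hM.le

/-- Away from the origin the truncated convolutions are controlled by the smoothness of the kernel
and the vanishing mean of `ψ`. -/
lemma IsCZKernel.abs_setIntegral_le_of_one_le_hnorm {n N : ℕ} {K : Heis n → ℝ} {C₀ : ℝ}
    (hK : IsCZKernel n N K C₀) (hC₀ : 0 ≤ C₀) {ψ : Heis n → ℝ} (hψ : Integrable ψ)
    (hsupp : Function.support ψ ⊆ {g | hnorm g ≤ 1 / 8}) (hmean : ∫ g, ψ g = 0) {r : ℝ}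
    (hr : 0 < r) {g : Heis n} (hg : 1 ≤ hnorm g) {η : ℝ} (hη : 0 < η) (hηg : η < hnorm g / 2) :
    |∫ h in {h : Heis n | η < hnorm h}, ψ (hmul g (hinv h)) * hdilNorm r K h| ≤
      C₀ * 2 ^ (2 * n + 4) / hnorm g ^ (2 * n + 3) * ∫ u, |ψ u| := by
  set S : Set (Heis n) := {h | η < hnorm h} with hS
  set B := C₀ * 2 ^ (2 * n + 4) / hnorm g ^ (2 * n + 3) with hB
  have hT := measurePreserving_hmul_hinv g
  have hTe : MeasurableEmbedding fun h : Heis n => hmul g (hinv h) := by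
    refine Continuous.measurableEmbedding (by unfold hmul hinv; fun_prop) fun h h' he => ?_
    simp only [hmul, hinv, Prod.mk.injEq, add_right_inj, neg_inj] at he
    obtain ⟨h1, h2, h3⟩ := he
    rw [h1, h2] at h3
    exact Prod.ext h1 (Prod.ext h2 (by linarith))
  have hSm : MeasurableSet S := (isOpen_lt continuous_const continuous_hnorm).measurableSet
  have hest : ∀ h, ψ (hmul g (hinv h)) ≠ 0 →
      hnorm g / 2 ≤ hnorm h ∧ |hdilNorm r K h - hdilNorm r K g| ≤ B := fun h hh =>
    hK.abs_hdilNorm_sub_le hC₀ hr hg (hsupp hh)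
  have hint : Integrable fun h => ψ (hmul g (hinv h)) := hT.integrable_comp_of_integrable hψ
  have hzero : ∫ h in S, ψ (hmul g (hinv h)) = 0 := by
    rw [setIntegral_eq_integral_of_forall_compl_eq_zero, hT.integral_comp hTe, hmean]
    intro h hh
    by_contra h0
    exact hh (hηg.trans_le (hest h h0).1)
  have hle : ∀ h, ‖ψ (hmul g (hinv h)) * (hdilNorm r K h - hdilNorm r K g)‖ ≤
      B * |ψ (hmul g (hinv h))| := by
    intro h
    rw [norm_mul, Real.norm_eq_abs, Real.norm_eq_abs, mul_comm]
    by_cases h0 : ψ (hmul g (hinv h)) = 0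
    · simp [h0]
    · exact mul_le_mul_of_nonneg_right (hest h h0).2 (abs_nonneg _)
  have hKc : ContinuousOn (hdilNorm r K) S := by
    refine continuousOn_const.mul (hK.1.continuousOn.comp (continuous_hdil r).continuousOn ?_)
    intro h hh
    refine ne_zero_of_hnorm_pos ?_
    rw [hnorm_hdil hr.le]
    exact mul_pos hr (hη.trans hh)
  have hint2 : IntegrableOn
      (fun h => ψ (hmul g (hinv h)) * (hdilNorm r K h - hdilNorm r K g)) S := by
    refine Integrable.mono' (hint.abs.const_mul B).integrableOn ?_ (Eventually.of_forall hle)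
    exact hint.aestronglyMeasurable.restrict.mul
      ((hKc.sub continuousOn_const).aestronglyMeasurable hSm)
  have hsplit : ∫ h in S, ψ (hmul g (hinv h)) * hdilNorm r K h =
      ∫ h in S, ψ (hmul g (hinv h)) * (hdilNorm r K h - hdilNorm r K g) := by
    calc ∫ h in S, ψ (hmul g (hinv h)) * hdilNorm r K h
        = ∫ h in S, (ψ (hmul g (hinv h)) * (hdilNorm r K h - hdilNorm r K g) +
            ψ (hmul g (hinv h)) * hdilNorm r K g) := by
          refine integral_congr_ae (Eventually.of_forall fun h => ?_)
          ring
      _ = _ := by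
          rw [integral_add hint2 (hint.integrableOn.mul_const _), integral_mul_const, hzero,
            zero_mul, add_zero]
  rw [hsplit, ← Real.norm_eq_abs]
  calc ‖∫ h in S, ψ (hmul g (hinv h)) * (hdilNorm r K h - hdilNorm r K g)‖
      ≤ ∫ h in S, B * |ψ (hmul g (hinv h))| :=
        norm_integral_le_of_norm_le (hint.abs.const_mul B).integrableOn (Eventually.of_forall hle)
    _ ≤ ∫ h, B * |ψ (hmul g (hinv h))| :=
        setIntegral_le_integral (hint.abs.const_mul B)
          (Eventually.of_forall fun h => (norm_nonneg _).trans (hle h))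
    _ = B * ∫ u, |ψ u| := by
        rw [integral_const_mul, hT.integral_comp hTe fun u => |ψ u|]

/-- The decay estimate for `ψ ∗ D_{2^{-j}} K`, for any order `N` of the bump functions in the
cancellation condition. -/
theorem IsCZKernel.exists_decay {n N : ℕ} {K : Heis n → ℝ} {C₀ : ℝ} (hC₀ : 0 < C₀)
    (hK : IsCZKernel n N K C₀) {ψ : Heis n → ℝ} (hψ : ContDiff ℝ (⊤ : ℕ∞) ψ)
    (hsupp : Function.support ψ ⊆ {g | hnorm g ≤ 1 / 8}) (hmean : ∫ g, ψ g = 0)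
    {Φ : ℤ → Heis n → ℝ}
    (hΦ : ∀ (j : ℤ) (g : Heis n), Tendsto (fun η : ℝ => ∫ h in {h : Heis n | η < hnorm h},
      ψ (hmul g (hinv h)) * hdilNorm ((2 : ℝ) ^ (-j)) K h)
        (nhdsWithin 0 (Set.Ioi 0)) (nhds (Φ j g))) :
    ∃ C : ℝ, 0 < C ∧ ∀ (j : ℤ) (g : Heis n), |Φ j g| ≤ C / (1 + hnorm g) ^ (2 * n + 3) := by
  obtain ⟨M, hM, hMb⟩ := hK.exists_bound_of_hnorm_le_one hψ hsupp
  have hint : Integrable ψ := hψ.continuous.integrable_of_hasCompactSupport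
    ((isCompact_hnorm_le (1 / 8)).of_isClosed_subset (isClosed_tsupport ψ)
      (closure_minimal hsupp (isClosed_le continuous_hnorm continuous_const)))
  set L := ∫ u, |ψ u| with hL
  have hL0 : 0 ≤ L := integral_nonneg fun u => abs_nonneg _
  refine ⟨2 ^ (2 * n + 3) * (M * C₀ + C₀ * 2 ^ (2 * n + 4) * L), by positivity, fun j g => ?_⟩
  have hg0 := hnorm_nonneg g
  have hr : (0 : ℝ) < 2 ^ (-j) := by positivity
  rw [le_div_iff₀ (by positivity)]
  rcases le_total (hnorm g) 1 with hg | hg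
  · have hb : |Φ j g| ≤ M * C₀ := le_of_tendsto (hΦ j g).abs
      (eventually_nhdsWithin_of_forall fun η hη => hMb _ hr g hg η hη)
    calc |Φ j g| * (1 + hnorm g) ^ (2 * n + 3) ≤ (M * C₀) * 2 ^ (2 * n + 3) := by
          gcongr
          linarith
      _ ≤ 2 ^ (2 * n + 3) * (M * C₀ + C₀ * 2 ^ (2 * n + 4) * L) := by
          rw [mul_comm]
          gcongr
          exact le_add_of_nonneg_right (by positivity)
  · have hb : |Φ j g| ≤ C₀ * 2 ^ (2 * n + 4) / hnorm g ^ (2 * n + 3) * L := by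
      refine le_of_tendsto (hΦ j g).abs ?_
      filter_upwards [Ioo_mem_nhdsGT (show (0 : ℝ) < hnorm g / 2 by linarith)] with η hη
      exact hK.abs_setIntegral_le_of_one_le_hnorm hC₀.le hint hsupp hmean hr hg hη.1 hη.2
    have hρ : 0 < hnorm g := by linarith
    calc |Φ j g| * (1 + hnorm g) ^ (2 * n + 3)
        ≤ (C₀ * 2 ^ (2 * n + 4) / hnorm g ^ (2 * n + 3) * L) * (2 * hnorm g) ^ (2 * n + 3) := by
          gcongr
          linarith
      _ = 2 ^ (2 * n + 3) * (C₀ * 2 ^ (2 * n + 4) * L) := by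
          rw [mul_pow]
          field_simp
      _ ≤ 2 ^ (2 * n + 3) * (M * C₀ + C₀ * 2 ^ (2 * n + 4) * L) := by
          gcongr
          exact le_add_of_nonneg_left (by positivity)

theorem stmt9 (n : ℕ) (hn : 1 ≤ n) :
    ∃ N : ℕ, ∃ c₀ : ℝ, 0 < c₀ ∧ c₀ < 1 ∧
      ∀ (K : Heis n → ℝ) (C₀ : ℝ), 0 < C₀ → IsCZKernel n N K C₀ →
        ∀ ψ : Heis n → ℝ, ContDiff ℝ (⊤ : ℕ∞) ψ →
          Function.support ψ ⊆ {g : Heis n | hnorm g ≤ c₀} →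
          (∫ g, ψ g) = 0 →
          ∀ Φ : ℤ → Heis n → ℝ,
            (∀ (j : ℤ) (g : Heis n),
              Tendsto (fun η : ℝ => ∫ h in {h : Heis n | η < hnorm h},
                  ψ (hmul g (hinv h)) * hdilNorm ((2 : ℝ) ^ (-j)) K h)
                (nhdsWithin 0 (Set.Ioi 0)) (nhds (Φ j g))) →
            ∃ C : ℝ, 0 < C ∧ ∀ (j : ℤ) (g : Heis n),
              |Φ j g| ≤ C / (1 + hnorm g) ^ (2 * n + 3) := by
  exact ⟨2 * n + 4, 1 / 8, by norm_num, by norm_num, fun K C₀ hC₀ hK ψ hψ hsupp hmean Φ hΦ =>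
    hK.exists_decay hC₀ hψ hsupp hmean hΦ⟩
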